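/- arXiv:2412.18950 — 2 statements merged into one kernel-verified Lean document; each statement's English description precedes it below -/
import Mathlib

section
/- The optimal control is unique: if u₁ and u₂ are controls with J(u₁) ≤ J(v) and J(u₂) ≤ J(v) for every control v, then u₁(t) = u₂(t) for all t ∈ [0, t_f]. -/
open Matrix MeasureTheory

/-- Midpoint form of the parallelogram law for the dot product. -/
theorem dotProduct_midpoint_self {ι : Type*} [Fintype ι] (x y : ι → ℝ) :
    ((1 / 2 : ℝ) • (x + y)) ⬝ᵥ ((1 / 2 : ℝ) • (x + y)) =
      (1 / 2) * (x ⬝ᵥ x + y ⬝ᵥ y) - (1 / 4) * ((x - y) ⬝ᵥ (x - y)) := by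
  simp only [smul_dotProduct, dotProduct_smul, add_dotProduct, dotProduct_add, sub_dotProduct,
    dotProduct_sub, smul_eq_mul, dotProduct_comm y x]
  ring

/-- The dot product of two functions continuous on `s` is continuous on `s`. -/
theorem ContinuousOn.dotProduct_real {α ι : Type*} [TopologicalSpace α] [Fintype ι] {s : Set α}
    {f g : α → ι → ℝ} (hf : ContinuousOn f s) (hg : ContinuousOn g s) :
    ContinuousOn (fun t => f t ⬝ᵥ g t) s :=
  continuousOn_iff_continuous_domRestrict.2
    ((continuousOn_iff_continuous_domRestrict.1 hf).dotProduct
      (continuousOn_iff_continuous_domRestrict.1 hg))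

/-- The quadratic running cost along continuous trajectories is continuous. -/
theorem continuousOn_quadratic_cost {k m n : ℕ} {s : Set ℝ} (C : Matrix (Fin k) (Fin m) ℝ) (μ : ℝ)
    {e : ℝ → Fin m → ℝ} {u : ℝ → Fin n → ℝ} (he : ContinuousOn e s) (hu : ContinuousOn u s) :
    ContinuousOn (fun t => (C *ᵥ e t) ⬝ᵥ (C *ᵥ e t) + μ * (u t ⬝ᵥ u t)) s := by
  have hC : ContinuousOn (fun t => C *ᵥ e t) s :=
    (Continuous.matrix_mulVec continuous_const continuous_id).comp_continuousOn he
  exact (hC.dotProduct_real hC).add (continuousOn_const.mul (hu.dotProduct_real hu))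

/-- The optimal control is unique: if `u₁` and `u₂` are controls
with `J(u₁) ≤ J(v)` and `J(u₂) ≤ J(v)` for every control `v`, then
`u₁(t) = u₂(t)` for all `t ∈ [0, t_f]`. -/
theorem fom_optimal_control_unique
    (m nc : ℕ) (t_f : ℝ) (ht_f : 0 < t_f)
    (A : Matrix (Fin m) (Fin m) ℝ) (B : Matrix (Fin m) (Fin nc) ℝ)
    (C : Matrix (Fin m) (Fin m) ℝ) (μ : ℝ) (hμ : 0 < μ)
    (q0 : Fin m → ℝ) (qd : ℝ → Fin m → ℝ)
    (hqd : ContinuousOn qd (Set.Icc (0:ℝ) t_f))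
    -- the two controls and their states
    (u1 u2 : ℝ → Fin nc → ℝ)
    (hu1 : ContinuousOn u1 (Set.Icc (0:ℝ) t_f))
    (hu2 : ContinuousOn u2 (Set.Icc (0:ℝ) t_f))
    (q1 : ℝ → Fin m → ℝ) (hq10 : q1 0 = q0)
    (hq1ode : ∀ t ∈ Set.Icc (0:ℝ) t_f, HasDerivAt q1 (A *ᵥ q1 t + B *ᵥ u1 t) t)
    (q2 : ℝ → Fin m → ℝ) (hq20 : q2 0 = q0)
    (hq2ode : ∀ t ∈ Set.Icc (0:ℝ) t_f, HasDerivAt q2 (A *ᵥ q2 t + B *ᵥ u2 t) t)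
    -- `u₁` is a global minimizer
    (hopt1 : ∀ v : ℝ → Fin nc → ℝ, ContinuousOn v (Set.Icc (0:ℝ) t_f) →
      ∀ qv : ℝ → Fin m → ℝ, qv 0 = q0 →
      (∀ t ∈ Set.Icc (0:ℝ) t_f, HasDerivAt qv (A *ᵥ qv t + B *ᵥ v t) t) →
      (1/2) * (∫ t in (0:ℝ)..t_f,
          ((C *ᵥ (q1 t - qd t)) ⬝ᵥ (C *ᵥ (q1 t - qd t)) + μ * (u1 t ⬝ᵥ u1 t)))
        ≤ (1/2) * (∫ t in (0:ℝ)..t_f,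
          ((C *ᵥ (qv t - qd t)) ⬝ᵥ (C *ᵥ (qv t - qd t)) + μ * (v t ⬝ᵥ v t))))
    -- `u₂` is a global minimizer
    (hopt2 : ∀ v : ℝ → Fin nc → ℝ, ContinuousOn v (Set.Icc (0:ℝ) t_f) →
      ∀ qv : ℝ → Fin m → ℝ, qv 0 = q0 →
      (∀ t ∈ Set.Icc (0:ℝ) t_f, HasDerivAt qv (A *ᵥ qv t + B *ᵥ v t) t) →
      (1/2) * (∫ t in (0:ℝ)..t_f,
          ((C *ᵥ (q2 t - qd t)) ⬝ᵥ (C *ᵥ (q2 t - qd t)) + μ * (u2 t ⬝ᵥ u2 t)))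
        ≤ (1/2) * (∫ t in (0:ℝ)..t_f,
          ((C *ᵥ (qv t - qd t)) ⬝ᵥ (C *ᵥ (qv t - qd t)) + μ * (v t ⬝ᵥ v t)))) :
    ∀ t ∈ Set.Icc (0:ℝ) t_f, u1 t = u2 t := by
  intro t ht
  have hq1 : ContinuousOn q1 (Set.Icc 0 t_f) :=
    fun s hs => (hq1ode s hs).continuousAt.continuousWithinAt
  have hq2 : ContinuousOn q2 (Set.Icc 0 t_f) :=
    fun s hs => (hq2ode s hs).continuousAt.continuousWithinAt
  have hL1 := continuousOn_quadratic_cost C μ (hq1.sub hqd) hu1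
  have hL2 := continuousOn_quadratic_cost C μ (hq2.sub hqd) hu2
  have hD := continuousOn_quadratic_cost C μ (hq1.sub hq2) (hu1.sub hu2)
  have hmid : ∀ s, (C *ᵥ ((1 / 2 : ℝ) • (q1 s + q2 s) - qd s)) ⬝ᵥ
        (C *ᵥ ((1 / 2 : ℝ) • (q1 s + q2 s) - qd s)) +
        μ * (((1 / 2 : ℝ) • (u1 s + u2 s)) ⬝ᵥ ((1 / 2 : ℝ) • (u1 s + u2 s))) =
      (1 / 2) * (((C *ᵥ (q1 s - qd s)) ⬝ᵥ (C *ᵥ (q1 s - qd s)) + μ * (u1 s ⬝ᵥ u1 s)) +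
        ((C *ᵥ (q2 s - qd s)) ⬝ᵥ (C *ᵥ (q2 s - qd s)) + μ * (u2 s ⬝ᵥ u2 s))) -
      (1 / 4) * ((C *ᵥ (q1 s - q2 s)) ⬝ᵥ (C *ᵥ (q1 s - q2 s)) +
        μ * ((u1 s - u2 s) ⬝ᵥ (u1 s - u2 s))) := by
    intro s
    have he : C *ᵥ ((1 / 2 : ℝ) • (q1 s + q2 s) - qd s) =
        (1 / 2 : ℝ) • (C *ᵥ (q1 s - qd s) + C *ᵥ (q2 s - qd s)) := by
      rw [← mulVec_add, ← mulVec_smul]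
      congr 1
      module
    have hd : C *ᵥ (q1 s - q2 s) = C *ᵥ (q1 s - qd s) - C *ᵥ (q2 s - qd s) := by
      rw [← mulVec_sub, sub_sub_sub_cancel_right]
    rw [he, hd, dotProduct_midpoint_self, dotProduct_midpoint_self]
    ring
  have hvode : ∀ s ∈ Set.Icc (0 : ℝ) t_f, HasDerivAt (fun s => (1 / 2 : ℝ) • (q1 s + q2 s))
      (A *ᵥ ((1 / 2 : ℝ) • (q1 s + q2 s)) + B *ᵥ ((1 / 2 : ℝ) • (u1 s + u2 s))) s := by
    intro s hs
    refine (((hq1ode s hs).add (hq2ode s hs)).const_smul (1 / 2 : ℝ)).congr_deriv ?_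
    simp only [mulVec_smul, mulVec_add]
    module
  have hv0 : (1 / 2 : ℝ) • (q1 0 + q2 0) = q0 := by
    rw [hq10, hq20]
    module
  have hv : ContinuousOn (fun s => (1 / 2 : ℝ) • (u1 s + u2 s)) (Set.Icc 0 t_f) :=
    (hu1.add hu2).const_smul (1 / 2 : ℝ)
  have h1 := hopt1 _ hv _ hv0 hvode
  have h2 := hopt2 _ hv _ hv0 hvode
  have hi1 := hL1.intervalIntegrable_of_Icc (μ := volume) ht_f.le
  have hi2 := hL2.intervalIntegrable_of_Icc (μ := volume) ht_f.le
  have hiD := hD.intervalIntegrable_of_Icc (μ := volume) ht_f.le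
  simp only [Pi.sub_apply] at hi1 hi2 hiD hD
  simp only [hmid] at h1 h2
  rw [intervalIntegral.integral_sub ((hi1.add hi2).const_mul _) (hiD.const_mul _),
    intervalIntegral.integral_const_mul, intervalIntegral.integral_const_mul,
    intervalIntegral.integral_add hi1 hi2] at h1 h2
  have hnonneg : ∀ {n : ℕ} (x : Fin n → ℝ), 0 ≤ x ⬝ᵥ x := fun x =>
    Finset.sum_nonneg fun i _ => mul_self_nonneg (x i)
  by_contra hne
  have hpos := intervalIntegral.integral_pos ht_f hD
    (fun s _ => add_nonneg (hnonneg _) (mul_nonneg hμ.le (hnonneg _)))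
    ⟨t, ht, add_pos_of_nonneg_of_pos (hnonneg _) (mul_pos hμ ((hnonneg _).lt_of_ne'
      (dotProduct_self_eq_zero.not.2 (sub_ne_zero.2 hne))))⟩
  linarith
end

section
/- For all controls u and h, the function s ↦ J_r(u + s h) is differentiable at s = 0 with derivative ∫₀^{t_f} ⟨μ u(t) + Bᵀ U a_{λ,u}(t), h(t)⟩ dt. In particular, the adjoint obtained by Galerkin projection of the full-order adjoint equation with the same basis U yields the exact gradient of the POD-Galerkin reduced cost, i.e. the first-reduce-then-optimize and first-optimize-then-reduce approaches commute for POD-Galerkin with a common basis for state and adjoint. -/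
open Matrix MeasureTheory

theorem HasDerivAt.dotProduct {n : ℕ} {f g : ℝ → Fin n → ℝ} {f' g' : Fin n → ℝ} {t : ℝ}
    (hf : HasDerivAt f f' t) (hg : HasDerivAt g g' t) :
    HasDerivAt (fun t => f t ⬝ᵥ g t) (f' ⬝ᵥ g t + f t ⬝ᵥ g') t := by
  simp only [_root_.dotProduct, ← Finset.sum_add_distrib]
  exact HasDerivAt.fun_sum fun i _ => (hasDerivAt_pi.1 hf i).mul (hasDerivAt_pi.1 hg i)

theorem ContinuousOn.dotProduct {n : ℕ} {f g : ℝ → Fin n → ℝ} {S : Set ℝ}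
    (hf : ContinuousOn f S) (hg : ContinuousOn g S) :
    ContinuousOn (fun t => f t ⬝ᵥ g t) S :=
  (Continuous.dotProduct continuous_fst continuous_snd).comp_continuousOn (hf.prodMk hg)

theorem ContinuousOn.const_mulVec {k n : ℕ} (M : Matrix (Fin k) (Fin n) ℝ) {f : ℝ → Fin n → ℝ}
    {S : Set ℝ} (hf : ContinuousOn f S) : ContinuousOn (fun t => M *ᵥ f t) S :=
  (Continuous.matrix_mulVec continuous_const continuous_id).comp_continuousOn hf

/-- A solution of a homogeneous linear ODE with zero initial value vanishes. -/
theorem eq_zero_of_hasDerivAt_mulVec {n : ℕ} (M : Matrix (Fin n) (Fin n) ℝ) {T : ℝ}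
    {w : ℝ → Fin n → ℝ} (hw0 : w 0 = 0)
    (hw : ∀ t ∈ Set.Icc (0 : ℝ) T, HasDerivAt w (M *ᵥ w t) t) :
    ∀ t ∈ Set.Icc (0 : ℝ) T, w t = 0 := by
  have hlip := (LinearMap.toContinuousLinearMap (Matrix.mulVecLin M)).lipschitz
  have key : Set.EqOn w (fun _ => 0) (Set.Icc 0 T) :=
    ODE_solution_unique (v := fun _ x => M *ᵥ x) (fun _ => hlip)
      (fun t ht => (hw t ht).continuousAt.continuousWithinAt)
      (fun t ht => (hw t ⟨ht.1, ht.2.le⟩).hasDerivWithinAt) continuousOn_const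
      (fun t _ => by
        simpa using hasDerivWithinAt_const t (Set.Ici t) (0 : Fin n → ℝ)) hw0
  exact key

/-- Integration by parts for a linear ODE and its adjoint: the terminal value of the adjoint and
the initial value of the state both vanish, so the two sources pair to the same integral. -/
theorem integral_dotProduct_eq_of_adjoint {n : ℕ} (M : Matrix (Fin n) (Fin n) ℝ) {T : ℝ}
    (hT : 0 ≤ T) {z l f g : ℝ → Fin n → ℝ}
    (hf : ContinuousOn f (Set.Icc 0 T)) (hg : ContinuousOn g (Set.Icc 0 T))
    (hz0 : z 0 = 0) (hlT : l T = 0)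
    (hz : ∀ t ∈ Set.Icc (0 : ℝ) T, HasDerivAt z (M *ᵥ z t + f t) t)
    (hl : ∀ t ∈ Set.Icc (0 : ℝ) T, HasDerivAt l (-(Mᵀ *ᵥ l t + g t)) t) :
    ∫ t in (0 : ℝ)..T, g t ⬝ᵥ z t = ∫ t in (0 : ℝ)..T, l t ⬝ᵥ f t := by
  have hzc : ContinuousOn z (Set.Icc 0 T) := fun t ht =>
    (hz t ht).continuousAt.continuousWithinAt
  have hlc : ContinuousOn l (Set.Icc 0 T) := fun t ht =>
    (hl t ht).continuousAt.continuousWithinAt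
  have hi₁ : IntervalIntegrable (fun t => l t ⬝ᵥ f t) volume 0 T :=
    (hlc.dotProduct hf).intervalIntegrable_of_Icc hT
  have hi₂ : IntervalIntegrable (fun t => g t ⬝ᵥ z t) volume 0 T :=
    (hg.dotProduct hzc).intervalIntegrable_of_Icc hT
  have hd : ∀ t ∈ Set.uIcc (0 : ℝ) T,
      HasDerivAt (fun t => l t ⬝ᵥ z t) (l t ⬝ᵥ f t - g t ⬝ᵥ z t) t := by
    intro t ht
    rw [Set.uIcc_of_le hT] at ht
    convert (hl t ht).dotProduct (hz t ht) using 1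
    rw [neg_dotProduct, add_dotProduct, dotProduct_add, mulVec_transpose, ← dotProduct_mulVec]
    ring
  have := intervalIntegral.integral_eq_sub_of_hasDerivAt hd (hi₁.sub hi₂)
  rw [intervalIntegral.integral_sub hi₁ hi₂, hlT, hz0] at this
  simp only [zero_dotProduct, dotProduct_zero, sub_zero] at this
  linarith

/-- A half-integral of a quadratic polynomial in `s` has the linear coefficient as derivative
at `0`. -/
theorem hasDerivAt_half_integral_quadratic {T : ℝ} {F : ℝ → ℝ → ℝ} {a b c : ℝ → ℝ}
    (ha : IntervalIntegrable a volume 0 T) (hb : IntervalIntegrable b volume 0 T)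
    (hc : IntervalIntegrable c volume 0 T)
    (hF : ∀ s, ∀ t ∈ Set.uIcc 0 T, F s t = a t + (2 * s) * b t + s ^ 2 * c t) :
    HasDerivAt (fun s : ℝ => (1 / 2) * ∫ t in (0 : ℝ)..T, F s t)
      (∫ t in (0 : ℝ)..T, b t) 0 := by
  have hJ : (fun s : ℝ => (1 / 2) * ∫ t in (0 : ℝ)..T, F s t) = fun s =>
      (1 / 2) * ((∫ t in (0 : ℝ)..T, a t) + (2 * s) * (∫ t in (0 : ℝ)..T, b t)
        + s ^ 2 * ∫ t in (0 : ℝ)..T, c t) := by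
    funext s
    rw [intervalIntegral.integral_congr (hF s),
      intervalIntegral.integral_add (ha.add (hb.const_mul _)) (hc.const_mul _),
      intervalIntegral.integral_add ha (hb.const_mul _),
      intervalIntegral.integral_const_mul, intervalIntegral.integral_const_mul]
  rw [hJ]
  refine (((((hasDerivAt_id (0 : ℝ)).const_mul 2).mul_const (∫ t in (0 : ℝ)..T, b t)).const_add
    (∫ t in (0 : ℝ)..T, a t) |>.add
      (((hasDerivAt_id (0 : ℝ)).pow 2).mul_const (∫ t in (0 : ℝ)..T, c t))).const_mul (1 / 2)).congr_deriv ?_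
  simp

/-- For the POD-Galerkin reduced problem with a basis `U`
(`UᵀU = I`), the map `s ↦ J_r(u + s h)` is differentiable at `s = 0` with
derivative `∫₀^{t_f} ⟨μ u(t) + Bᵀ U a_{λ,u}(t), h(t)⟩ dt`, where `a_{λ,u}` is the
Galerkin-projected (reduced) adjoint with the same basis `U`.  In particular the
first-reduce-then-optimize and first-optimize-then-reduce approaches commute for
POD-Galerkin with a common basis for state and adjoint. -/
theorem podg_reduced_cost_hasDerivAt
    (m nc pdim : ℕ) (t_f : ℝ) (ht_f : 0 < t_f)
    (A : Matrix (Fin m) (Fin m) ℝ) (B : Matrix (Fin m) (Fin nc) ℝ)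
    (C : Matrix (Fin m) (Fin m) ℝ) (μ : ℝ) (hμ : 0 < μ)
    (q0 : Fin m → ℝ) (qd : ℝ → Fin m → ℝ)
    (hqd : ContinuousOn qd (Set.Icc (0:ℝ) t_f))
    -- the POD basis with orthonormal columns
    (U : Matrix (Fin m) (Fin pdim) ℝ) (hU : Uᵀ * U = 1)
    -- the controls `u` and `h`
    (u h : ℝ → Fin nc → ℝ)
    (hu : ContinuousOn u (Set.Icc (0:ℝ) t_f))
    (hh : ContinuousOn h (Set.Icc (0:ℝ) t_f))
    -- for every `s`, `as s` is the reduced state corresponding to `u + s h`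
    (as : ℝ → ℝ → Fin pdim → ℝ)
    (has0 : ∀ s : ℝ, as s 0 = Uᵀ *ᵥ q0)
    (hasode : ∀ s : ℝ, ∀ t ∈ Set.Icc (0:ℝ) t_f,
      HasDerivAt (as s) ((Uᵀ * A * U) *ᵥ as s t + (Uᵀ * B) *ᵥ (u t + s • h t)) t)
    -- `alam` is the reduced adjoint corresponding to `u` (reduced state `as 0`)
    (alam : ℝ → Fin pdim → ℝ)
    (halamf : alam t_f = 0)
    (halamode : ∀ t ∈ Set.Icc (0:ℝ) t_f,
      HasDerivAt alam
        (-((Uᵀ * Aᵀ * U) *ᵥ alam t + (Uᵀ * (Cᵀ * C)) *ᵥ (U *ᵥ as 0 t - qd t))) t) :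
    HasDerivAt
      (fun s : ℝ =>
        (1/2) * ∫ t in (0:ℝ)..t_f,
          ((C *ᵥ (U *ᵥ as s t - qd t)) ⬝ᵥ (C *ᵥ (U *ᵥ as s t - qd t))
            + μ * ((u t + s • h t) ⬝ᵥ (u t + s • h t))))
      (∫ t in (0:ℝ)..t_f, (μ • u t + Bᵀ *ᵥ (U *ᵥ alam t)) ⬝ᵥ h t) 0 := by
  set N := Uᵀ * B with hN
  set M := Uᵀ * A * U with hM
  have hMT : Uᵀ * Aᵀ * U = Mᵀ := by
    simp [hM, transpose_mul, Matrix.mul_assoc]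
  set z : ℝ → Fin pdim → ℝ := as 1 - as 0 with hz
  have hzode : ∀ t ∈ Set.Icc (0 : ℝ) t_f, HasDerivAt z (M *ᵥ z t + N *ᵥ h t) t := by
    intro t ht
    refine ((hasode 1 t ht).sub (hasode 0 t ht)).congr_deriv ?_
    simp only [hz, Pi.sub_apply, mulVec_sub, mulVec_add, one_smul, zero_smul, add_zero]
    abel
  have hz0 : z 0 = 0 := by simp [hz, has0]
  have hlin : ∀ s, ∀ t ∈ Set.Icc (0 : ℝ) t_f, as s t = as 0 t + s • z t := by
    intro s t ht
    have key := eq_zero_of_hasDerivAt_mulVec M (T := t_f) (w := as s - as 0 - s • z)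
      (by simp [hz0, has0]) (fun t ht => by
        refine (((hasode s t ht).sub (hasode 0 t ht)).sub
          ((hzode t ht).const_smul s)).congr_deriv ?_
        simp only [Pi.sub_apply, Pi.smul_apply, mulVec_sub, mulVec_add, mulVec_smul, smul_add,
          zero_smul, add_zero]
        abel) t ht
    simp only [Pi.sub_apply, Pi.smul_apply] at key
    rw [sub_sub, sub_eq_zero] at key
    exact key
  have hzc : ContinuousOn z (Set.Icc 0 t_f) := fun t ht =>
    (hzode t ht).continuousAt.continuousWithinAt
  have hac : ContinuousOn (as 0) (Set.Icc 0 t_f) := fun t ht =>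
    (hasode 0 t ht).continuousAt.continuousWithinAt
  have hlc : ContinuousOn alam (Set.Icc 0 t_f) := fun t ht =>
    (halamode t ht).continuousAt.continuousWithinAt
  have hec : ContinuousOn (fun t => U *ᵥ as 0 t - qd t) (Set.Icc 0 t_f) :=
    (hac.const_mulVec U).sub hqd
  have hCec := hec.const_mulVec C
  have hCzc := (hzc.const_mulVec U).const_mulVec C
  have hgc := hec.const_mulVec (Uᵀ * (Cᵀ * C))
  have hNc := hh.const_mulVec N
  have hadj := integral_dotProduct_eq_of_adjoint M ht_f.le hNc hgc hz0 halamf hzode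
    (by simpa only [hMT] using halamode)
  have hpair : ∀ t, (C *ᵥ (U *ᵥ as 0 t - qd t)) ⬝ᵥ (C *ᵥ (U *ᵥ z t))
      = ((Uᵀ * (Cᵀ * C)) *ᵥ (U *ᵥ as 0 t - qd t)) ⬝ᵥ z t := by
    intro t
    rw [← mulVec_mulVec, ← mulVec_mulVec, mulVec_transpose, mulVec_transpose,
      ← dotProduct_mulVec, ← dotProduct_mulVec]
  have hgrad : ∀ t, (μ • u t + Bᵀ *ᵥ (U *ᵥ alam t)) ⬝ᵥ h t
      = alam t ⬝ᵥ (N *ᵥ h t) + μ * (u t ⬝ᵥ h t) := by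
    intro t
    rw [add_dotProduct, smul_dotProduct, smul_eq_mul, mulVec_transpose, ← dotProduct_mulVec,
      hN, ← mulVec_mulVec, dotProduct_mulVec (alam t), vecMul_transpose, add_comm]
  have huh : IntervalIntegrable (fun t => μ * (u t ⬝ᵥ h t)) volume 0 t_f :=
    (continuousOn_const.mul (hu.dotProduct hh)).intervalIntegrable_of_Icc ht_f.le
  have hb := (hCec.dotProduct hCzc).intervalIntegrable_of_Icc (μ := volume) ht_f.le
  have hgradient : ∫ t in (0 : ℝ)..t_f, (μ • u t + Bᵀ *ᵥ (U *ᵥ alam t)) ⬝ᵥ h t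
      = ∫ t in (0 : ℝ)..t_f, ((C *ᵥ (U *ᵥ as 0 t - qd t)) ⬝ᵥ (C *ᵥ (U *ᵥ z t))
        + μ * (u t ⬝ᵥ h t)) := by
    rw [intervalIntegral.integral_add hb huh]
    simp only [hgrad, hpair]
    rw [intervalIntegral.integral_add
      ((hlc.dotProduct hNc).intervalIntegrable_of_Icc ht_f.le) huh, hadj]
  rw [hgradient]
  refine hasDerivAt_half_integral_quadratic
    (a := fun t => (C *ᵥ (U *ᵥ as 0 t - qd t)) ⬝ᵥ (C *ᵥ (U *ᵥ as 0 t - qd t))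
      + μ * (u t ⬝ᵥ u t))
    (c := fun t => (C *ᵥ (U *ᵥ z t)) ⬝ᵥ (C *ᵥ (U *ᵥ z t)) + μ * (h t ⬝ᵥ h t))
    (((hCec.dotProduct hCec).add
      (continuousOn_const.mul (hu.dotProduct hu))).intervalIntegrable_of_Icc ht_f.le) (hb.add huh)
    (((hCzc.dotProduct hCzc).add
      (continuousOn_const.mul (hh.dotProduct hh))).intervalIntegrable_of_Icc ht_f.le) ?_
  intro s t ht
  rw [Set.uIcc_of_le ht_f.le] at ht
  have he : C *ᵥ (U *ᵥ as s t - qd t)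
      = C *ᵥ (U *ᵥ as 0 t - qd t) + s • (C *ᵥ (U *ᵥ z t)) := by
    rw [hlin s t ht, mulVec_add, mulVec_smul, add_sub_right_comm, mulVec_add, mulVec_smul]
  simp only [he, add_dotProduct, dotProduct_add, smul_dotProduct, dotProduct_smul, smul_eq_mul]
  rw [dotProduct_comm (C *ᵥ (U *ᵥ z t)) (C *ᵥ (U *ᵥ as 0 t - qd t)),
    dotProduct_comm (h t) (u t)]
  ring
end
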